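/- arXiv:1609.04099 — 2 statements merged into one kernel-verified Lean document; each statement's English description precedes it below -/
import Mathlib

section
/- Let → be a binary relation on a sequentially compact topological space S, let α be a countable ordinal, and let (s_β)_{β<α} be an α-sequence of →. If there is no s_α ∈ S such that (s_β)_{β≤α} is an (α+1)-sequence of →, then α is a successor ordinal, α = α' + 1, and s_{α'} is a sink of → (no t ∈ S satisfies s_{α'} → t). -/
/-- An `α`-sequence of a binary relation `→ₛ` on a topological space: a family
`(s_β)_{β<α}` such that `s_β →ₛ s_{β+1}` whenever `β + 1 < α`, and at each limit ordinal
`β < α`, for every `β' < β` and every neighbourhood `U` of `s_β` there is `γ` with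
`β' < γ < β` and `s_γ ∈ U`. (The family is encoded as a total function
`s : Ordinal → S`; only the values at `β < α` are constrained.) -/
def IsOrdSeq {S : Type*} [TopologicalSpace S] (r : S → S → Prop) (α : Ordinal)
    (s : Ordinal → S) : Prop :=
  (∀ β : Ordinal, β + 1 < α → r (s β) (s (β + 1))) ∧
  (∀ β : Ordinal, β < α → Order.IsSuccLimit β →
    ∀ β' < β, ∀ U ∈ nhds (s β), ∃ γ : Ordinal, β' < γ ∧ γ < β ∧ s γ ∈ U)

/-- To extend an `α`-sequence it is enough to satisfy the condition at the new index `α`. -/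
lemma IsOrdSeq.extend {S : Type*} [TopologicalSpace S] {r : S → S → Prop} {α : Ordinal}
    {s : Ordinal → S} (hs : IsOrdSeq r α s) (x : S)
    (h1 : ∀ β : Ordinal, β + 1 = α → r (s β) x)
    (h2 : Order.IsSuccLimit α →
      ∀ β' < α, ∀ U ∈ nhds x, ∃ γ : Ordinal, β' < γ ∧ γ < α ∧ s γ ∈ U) :
    IsOrdSeq r (α + 1) (fun β => if β = α then x else s β) := by
  refine ⟨fun β hβ => ?_, fun β hβ hlim β' hβ' U hU => ?_⟩
  · have hle : β + 1 ≤ α := Order.lt_add_one_iff.1 hβ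
    have hlt : β < α := lt_of_lt_of_le (Order.lt_add_one_iff.2 le_rfl) hle
    rcases hle.eq_or_lt with h | h
    · simpa [hlt.ne, h] using h1 β h
    · simpa [hlt.ne, h.ne] using hs.1 β h
  · have hle : β ≤ α := Order.lt_add_one_iff.1 hβ
    have key : ∃ γ : Ordinal, β' < γ ∧ γ < β ∧ s γ ∈ U := by
      rcases hle.eq_or_lt with h | h
      · subst h
        exact h2 hlim β' hβ' U (by simpa using hU)
      · exact hs.2 β h hlim β' hβ' U (by simpa [h.ne] using hU)
    obtain ⟨γ, h1, h2, h3⟩ := key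
    exact ⟨γ, h1, h2, by simpa [(h2.trans_le hle).ne] using h3⟩

/-- If a countable ordinal sequence of a relation `→ₛ` over a (nonempty) sequentially
compact space cannot be extended by any choice of a next element, then its length is a
successor ordinal `α = α' + 1` and its last element `s_{α'}` is a sink of `→ₛ`. -/
theorem ordSeq_not_extendable_iff_sink {S : Type*} [TopologicalSpace S]
    [SeqCompactSpace S] [Nonempty S]
    (r : S → S → Prop) (α : Ordinal) (hcount : α.card ≤ Cardinal.aleph0)
    (s : Ordinal → S) (hs : IsOrdSeq r α s)
    (hext : ¬ ∃ x : S, IsOrdSeq r (α + 1) (fun β => if β = α then x else s β)) :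
    ∃ α' : Ordinal, α = α' + 1 ∧ ∀ t : S, ¬ r (s α') t := by
  rcases Ordinal.zero_or_succ_or_isSuccLimit α with h0 | ⟨a, ha⟩ | hlim
  · refine absurd ⟨Classical.arbitrary S, hs.extend _ (fun β hβ => ?_) (fun h => ?_)⟩ hext
    · rw [h0] at hβ
      exact absurd hβ (by simp)
    · rw [h0] at h
      exact absurd h (by simp)
  · have ha' : α = a + 1 := by first | exact ha | exact ha.symm
    refine ⟨a, ha', fun t ht => hext ⟨t, hs.extend _ (fun β hβ => ?_) (fun h => ?_)⟩⟩
    · have : β = a := by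
        rw [ha'] at hβ
        simpa using hβ
      rwa [this]
    · rw [ha'] at h
      exact absurd h (by simp)
  · exfalso
    have hc : Countable (Set.Iio α) := by
      rw [← Cardinal.mk_le_aleph0_iff, Cardinal.mk_Iio_ordinal]
      simpa [-Ordinal.lift_card] using hcount
    have hne : Nonempty (Set.Iio α) := ⟨⟨0, hlim.bot_lt⟩⟩
    obtain ⟨f, hf⟩ := Filter.exists_seq_tendsto (Filter.atTop : Filter (Set.Iio α))
    obtain ⟨x, φ, hφ, hx⟩ := SeqCompactSpace.tendsto_subseq (fun n => s (f n))
    refine hext ⟨x, hs.extend x (fun β hβ => ?_) (fun _ β' hβ' U hU => ?_)⟩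
    · rw [← hβ] at hlim
      exact absurd hlim (by simp)
    · have h1 : β' + 1 < α := hlim.succ_lt hβ'
      have e1 := (hf.comp hφ.tendsto_atTop).eventually
        (Filter.eventually_ge_atTop (⟨β' + 1, h1⟩ : Set.Iio α))
      obtain ⟨n, hn, hnU⟩ := (e1.and (hx.eventually hU)).exists
      have hn' : β' + 1 ≤ (f (φ n) : Ordinal) := hn
      exact ⟨f (φ n), Order.add_one_le_iff.1 hn', (f (φ n)).2, hnU⟩
end

section
/- Let g be an infinite sequential game with finite branching and finitely many players, each having a win-lose objective whose winning set is a Δ⁰₂-set in the space of plays. Then every maximal ordinal-indexed sequence of lazy improvement steps in g is countable and ends at a Nash equilibrium: it has a last element s which is a sink of the lazy improvement relation, and s is a Nash equilibrium of g. -/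
/-!
An infinite sequential game is modelled on the full infinite rooted tree whose vertices
are the finite sequences (`List M`) of moves in `M`: `d : List M → A` assigns an owner to
each vertex, and `v : (ℕ → M) → O` assigns an outcome to each maximal path (play) from
the root. A strategy profile chooses one outgoing edge at each vertex, i.e. it is a
function `s : List M → M`.
-/

namespace InfGame

/-- The finite prefix of length `n` of the play induced by a strategy profile `s`. -/
def playPrefix {M : Type*} (s : List M → M) : ℕ → List M
  | 0 => []
  | n+1 => playPrefix s n ++ [s (playPrefix s n)]

/-- The play (maximal path from the root) induced by a strategy profile `s`. -/
def play {M : Type*} (s : List M → M) : ℕ → M :=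
  fun n => s (playPrefix s n)

/-- Vertex `h` lies on the play induced by the strategy profile `s`. -/
def OnPlay {M : Type*} (s : List M → M) (h : List M) : Prop :=
  h = playPrefix s h.length

/-- Player `a` can lazily convert `s` into `s'` (`s ⇀ᶜ_a s'`): every vertex at which `s`
and `s'` differ is owned by `a` and lies on the play induced by `s'`. -/
def LazyConv {A M : Type*} (d : List M → A) (a : A) (s s' : List M → M) : Prop :=
  ∀ h : List M, s h ≠ s' h → d h = a ∧ OnPlay s' h

/-- Player `a` can convert `s` into `s'` (`s ↠ᶜ_a s'`): every vertex at which `s` and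
`s'` differ is owned by `a`. -/
def Conv {A M : Type*} (d : List M → A) (a : A) (s s' : List M → M) : Prop :=
  ∀ h : List M, s h ≠ s' h → d h = a

/-- The collective lazy improvement relation `⇀` of an infinite sequential game with
outcome function `v` and preferences `prec`. -/
def Lazy {A M O : Type*} (d : List M → A) (v : (ℕ → M) → O)
    (prec : A → O → O → Prop) (s s' : List M → M) : Prop :=
  ∃ a : A, LazyConv d a s s' ∧ prec a (v (play s)) (v (play s'))

/-- The collective improvement relation `↠` of an infinite sequential game. -/
def Improve {A M O : Type*} (d : List M → A) (v : (ℕ → M) → O)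
    (prec : A → O → O → Prop) (s s' : List M → M) : Prop :=
  ∃ a : A, Conv d a s s' ∧ prec a (v (play s)) (v (play s'))

end InfGame

/-- A relation is acyclic if it admits no finite cycle `x₀ ≺ x₁ ≺ … ≺ x_k ≺ x₀`. -/
def Acyclic {X : Type*} (r : X → X → Prop) : Prop :=
  ∀ x, ¬ Relation.TransGen r x x

namespace InfGame

/-- The lazy improvement relation `⇀` of an infinite sequential game with win-lose
objectives given by the winning sets `W a`: player `a` lazily converts a losing profile
into a winning one. -/
def LazyWL {A M : Type*} (d : List M → A) (W : A → Set (ℕ → M))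
    (s s' : List M → M) : Prop :=
  ∃ a : A, LazyConv d a s s' ∧ play s ∉ W a ∧ play s' ∈ W a

end InfGame

/-- A `Δ⁰₂`-set: both a countable intersection of open sets and a countable union of
closed sets. -/
def IsDeltaTwo {X : Type*} [TopologicalSpace X] (W : Set X) : Prop :=
  (∃ U : ℕ → Set X, (∀ i, IsOpen (U i)) ∧ W = ⋂ i, U i) ∧
  (∃ C : ℕ → Set X, (∀ i, IsClosed (C i)) ∧ W = ⋃ i, C i)

namespace LazyProof

open InfGame Set Filter Topology

/-- The vertex of length `n` on the path `x`. -/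
def pre {M : Type*} (x : ℕ → M) (n : ℕ) : List M := (List.range n).map x

theorem pre_length {M : Type*} (x : ℕ → M) (n : ℕ) : (pre x n).length = n := by simp [pre]

theorem pre_succ {M : Type*} (x : ℕ → M) (n : ℕ) : pre x (n + 1) = pre x n ++ [x n] := by
  simp [pre, List.range_succ]

theorem playPrefix_eq_pre {M : Type*} (t : List M → M) (n : ℕ) :
    playPrefix t n = pre (play t) n := by
  induction n with
  | zero => rfl
  | succ n ih =>
    rw [pre_succ, playPrefix, ← ih]
    rfl

theorem pre_eq_iff {M : Type*} (x y : ℕ → M) (n : ℕ) :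
    pre x n = pre y n ↔ ∀ i < n, x i = y i := by
  simp [pre]

/-- `t` follows the path `x` at its first `n` vertices. -/
def Fol {M : Type*} (x : ℕ → M) (n : ℕ) (t : List M → M) : Prop :=
  ∀ i < n, t (pre x i) = x i

theorem fol_iff_prefix {M : Type*} (x : ℕ → M) (n : ℕ) (t : List M → M) :
    Fol x n t ↔ playPrefix t n = pre x n := by
  induction n with
  | zero => simp [Fol, playPrefix, pre]
  | succ n ih =>
    have h1 : Fol x (n + 1) t ↔ Fol x n t ∧ t (pre x n) = x n := by
      unfold Fol
      constructor
      · intro h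
        exact ⟨fun i hi => h i (by omega), h n (by omega)⟩
      · rintro ⟨h, h'⟩ i hi
        rcases Nat.lt_succ_iff_lt_or_eq.1 hi with h2 | rfl
        · exact h i h2
        · exact h'
    rw [h1, ih, playPrefix, pre_succ]
    constructor
    · rintro ⟨h, h'⟩
      rw [h, h']
    · intro h
      have h2 := List.append_inj' h rfl
      refine ⟨h2.1, ?_⟩
      rw [h2.1] at h2
      simpa using h2.2

theorem fol_iff_play {M : Type*} (x : ℕ → M) (n : ℕ) (t : List M → M) :
    Fol x n t ↔ ∀ i < n, play t i = x i := by
  rw [fol_iff_prefix, playPrefix_eq_pre, pre_eq_iff]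

theorem onPlay_pre {M : Type*} {x : ℕ → M} {k : ℕ} {t : List M → M}
    (h : OnPlay t (pre x k)) : Fol x k t := by
  rw [fol_iff_prefix]
  unfold OnPlay at h
  rw [pre_length] at h
  exact h.symm

/-- The last wrong vertex (before level `n`, relative to `x`) is owned by `a`. -/
def Inv {A M : Type*} (d : List M → A) (a : A) (x : ℕ → M) (n : ℕ) (t : List M → M) : Prop :=
  ∃ i < n, t (pre x i) ≠ x i ∧ d (pre x i) = a ∧ ∀ j, i < j → j < n → t (pre x j) = x j

theorem exists_first {M : Type*} {x : ℕ → M} {n : ℕ} {t : List M → M} (h : ¬ Fol x n t) :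
    ∃ j < n, t (pre x j) ≠ x j ∧ Fol x j t := by
  classical
  have h' : ∃ j, j < n ∧ t (pre x j) ≠ x j := by
    unfold Fol at h
    push Not at h
    exact h
  refine ⟨Nat.find h', (Nat.find_spec h').1, (Nat.find_spec h').2, fun i hi => ?_⟩
  have h2 := Nat.find_min h' hi
  have h3 := (Nat.find_spec h').1
  by_contra h4
  exact h2 ⟨by omega, h4⟩

theorem unchanged {A M : Type*} {d : List M → A} {b : A} {x : ℕ → M} {t t' : List M → M}
    (hc : LazyConv d b t t') {j k : ℕ} (hj : t' (pre x j) ≠ x j) (hk : j < k) :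
    t (pre x k) = t' (pre x k) := by
  by_contra h
  exact hj (onPlay_pre (hc _ h).2 j hk)

theorem exit_inv {A M : Type*} {d : List M → A} {a : A} {x : ℕ → M} {n : ℕ} {t t' : List M → M}
    (hc : LazyConv d a t t') (ht : Fol x n t) (ht' : ¬ Fol x n t') : Inv d a x n t' := by
  obtain ⟨j, hjn, hj, -⟩ := exists_first ht'
  refine ⟨j, hjn, hj, (hc _ ?_).1, fun k hk hkn => ?_⟩
  · rw [ht j hjn]
    exact hj.symm
  · rw [← unchanged hc hj hk, ht k hkn]

theorem step_inv {A M : Type*} {d : List M → A} {a b : A} {x : ℕ → M} {n : ℕ}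
    {t t' : List M → M} (hc : LazyConv d b t t') (hi : Inv d a x n t) :
    Inv d a x n t' ∨ (Fol x n t' ∧ b = a) := by
  obtain ⟨i, hin, hiw, hia, hir⟩ := hi
  by_cases hf : Fol x n t'
  · right
    refine ⟨hf, ?_⟩
    rw [← hia]
    refine (hc _ ?_).1.symm
    rw [hf i hin]
    exact hiw
  · left
    obtain ⟨j, hjn, hj, hjf⟩ := exists_first hf
    rcases lt_trichotomy j i with h | h | h
    · refine ⟨i, hin, ?_, hia, fun k hk hkn => ?_⟩
      · rw [← unchanged hc hj h]
        exact hiw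
      · rw [← unchanged hc hj (h.trans hk)]
        exact hir k hk hkn
    · subst h
      refine ⟨j, hin, hj, hia, fun k hk hkn => ?_⟩
      rw [← unchanged hc hj hk]
      exact hir k hk hkn
    · have hba : d (pre x i) = b := by
        refine (hc _ ?_).1
        rw [hjf i h]
        exact hiw
      have hjb : d (pre x j) = b := by
        refine (hc _ ?_).1
        rw [hir j h hjn]
        exact hj.symm
      refine ⟨j, hjn, hj, ?_, fun k hk hkn => ?_⟩
      · rw [hjb, ← hba, hia]
      · rw [← unchanged hc hj hk]
        exact hir k (h.trans hk) hkn

theorem agree_nhds {M : Type*} [TopologicalSpace M] [DiscreteTopology M]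
    (x : ℕ → M) (n : ℕ) (t : List M → M) :
    {t' : List M → M | ∀ i < n, t' (pre x i) = t (pre x i)} ∈ 𝓝 t := by
  have h : ∀ᶠ t' in 𝓝 t, ∀ i ∈ Finset.range n, t' (pre x i) = t (pre x i) := by
    rw [Filter.eventually_all_finset]
    intro i _
    have h1 : Continuous fun t' : List M → M => t' (pre x i) := continuous_apply _
    exact h1.continuousAt.eventually (by simp [nhds_discrete] :
      ∀ᶠ m in 𝓝 (t (pre x i)), m = t (pre x i))
  filter_upwards [h] with t' h i hi using h i (by simpa using hi)

/-- In a nonempty closed set of plays some cylinder decides all the winning sets. -/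
theorem exists_cylinder {A M : Type*} [Finite A] [Finite M] [TopologicalSpace M]
    [DiscreteTopology M] (W : A → Set (ℕ → M)) (hW : ∀ a, IsDeltaTwo (W a))
    (P : Set (ℕ → M)) (hP : IsClosed P) (hne : P.Nonempty) :
    ∃ x ∈ P, ∃ n : ℕ, ∀ y ∈ P, (∀ i < n, y i = x i) → ∀ a, (y ∈ W a ↔ x ∈ W a) := by
  have : CompactSpace P := isCompact_iff_compactSpace.1 hP.isCompact
  have : Nonempty P := hne.to_subtype
  have key : ∀ a : A, ∃ G : Set P, IsOpen G ∧ Dense G ∧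
      ∀ x ∈ G, ∀ᶠ y in 𝓝 x, (y.1 ∈ W a ↔ x.1 ∈ W a) := by
    intro a
    obtain ⟨⟨U, hU, hWU⟩, ⟨C, hC, hWC⟩⟩ := hW a
    let f : ℕ ⊕ ℕ → Set P := fun i => Sum.elim (fun i => Subtype.val ⁻¹' (U i)ᶜ)
      (fun i => Subtype.val ⁻¹' (C i)) i
    have hf : ∀ i, IsClosed (f i) := by
      rintro (i | i)
      · exact (hU i).isClosed_compl.preimage continuous_subtype_val
      · exact (hC i).preimage continuous_subtype_val
    have hcov : ⋃ i, f i = univ := by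
      rw [eq_univ_iff_forall]
      intro y
      rw [mem_iUnion]
      by_cases hy : y.1 ∈ W a
      · rw [hWC, mem_iUnion] at hy
        obtain ⟨i, hi⟩ := hy
        exact ⟨Sum.inr i, hi⟩
      · rw [hWU, mem_iInter] at hy
        push Not at hy
        obtain ⟨i, hi⟩ := hy
        exact ⟨Sum.inl i, hi⟩
    refine ⟨⋃ i, interior (f i), isOpen_iUnion fun i => isOpen_interior,
      dense_iUnion_interior_of_closed hf hcov, ?_⟩
    intro x hx
    obtain ⟨i, hi⟩ := mem_iUnion.1 hx
    have hxi := interior_subset hi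
    filter_upwards [mem_interior_iff_mem_nhds.1 hi] with y hy
    rcases i with i | i
    · have h1 : ∀ z ∈ f (Sum.inl i), z.1 ∉ W a := by
        intro z hz hzw
        rw [hWU, mem_iInter] at hzw
        exact hz (hzw i)
      exact iff_of_false (h1 y hy) (h1 x hxi)
    · have h1 : ∀ z ∈ f (Sum.inr i), z.1 ∈ W a := by
        intro z hz
        rw [hWC, mem_iUnion]
        exact ⟨i, hz⟩
      exact iff_of_true (h1 y hy) (h1 x hxi)
  choose G hGo hGd hG using key
  obtain ⟨x, hx⟩ := (dense_iInter_of_isOpen hGo hGd).nonempty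
  have hev : ∀ᶠ y in 𝓝 x, ∀ a, (y.1 ∈ W a ↔ x.1 ∈ W a) :=
    Filter.eventually_all.2 fun a => hG a x (mem_iInter.1 hx a)
  rw [nhds_subtype_eq_comap, Filter.eventually_comap] at hev
  obtain ⟨V, ⟨z, n, rfl⟩, hxV, hV⟩ :=
    (PiNat.isTopologicalBasis_cylinders (fun _ : ℕ => M)).mem_nhds_iff.1 hev
  refine ⟨x.1, x.2, n, fun y hy hyx => ?_⟩
  have hyV : y ∈ PiNat.cylinder z n := fun i hi => (hyx i hi).trans (hxV i hi)
  exact hV hyV ⟨y, hy⟩ rfl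

open Ordinal Cardinal in
theorem lt_omega_one {A M : Type*} [Finite A]
    [Finite M] [Nonempty M] [TopologicalSpace M] [DiscreteTopology M]
    (d : List M → A) (W : A → Set (ℕ → M))
    (hW : ∀ a : A, IsDeltaTwo (W a))
    (α : Ordinal) (s : Ordinal → (List M → M))
    (hs : IsOrdSeq (LazyWL d W) α s) : α < ω₁ := by
  by_contra hα
  rw [not_lt] at hα
  obtain ⟨hsucc, hlim⟩ := hs
  have hω : Order.IsSuccLimit (ω₁ : Ordinal) := isSuccLimit_omega 1
  have hω1 : ∀ β : Ordinal, β < ω₁ → β + 1 < ω₁ := fun β hβ => hω.add_one_lt hβ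
  -- bound of the visits of the vertices which are not visited unboundedly
  have hb : ∀ h : List M, ∃ b < (ω₁ : Ordinal), (∃ γ, b ≤ γ ∧ γ < ω₁ ∧
      playPrefix (s γ) h.length = h) → ∀ β < (ω₁ : Ordinal), ∃ γ, β ≤ γ ∧ γ < ω₁ ∧
      playPrefix (s γ) h.length = h := by
    intro h
    by_cases hh : ∀ β < (ω₁ : Ordinal), ∃ γ, β ≤ γ ∧ γ < ω₁ ∧ playPrefix (s γ) h.length = h
    · exact ⟨0, hω.bot_lt, fun _ => hh⟩
    · push Not at hh
      obtain ⟨b, hb, hb'⟩ := hh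
      refine ⟨b, hb, ?_⟩
      rintro ⟨γ, h1, h2, h3⟩
      exact absurd h3 (hb' γ h1 h2)
  choose b hbω hb using hb
  have hB : ∃ B < (ω₁ : Ordinal), ∀ h, b h ≤ B := by
    obtain ⟨e, he⟩ := exists_surjective_nat (List M)
    refine ⟨⨆ k, b (e k), Ordinal.iSup_lt_omega_one fun k => hbω _, fun h => ?_⟩
    obtain ⟨k, rfl⟩ := he h
    exact Ordinal.le_iSup (fun k => b (e k)) k
  obtain ⟨B, hBω, hB⟩ := hB
  obtain ⟨x, hxP, n, hx⟩ := exists_cylinder W hW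
    (closure (Set.image (fun β => play (s β)) {β | B ≤ β ∧ β < ω₁})) isClosed_closure
    (Set.Nonempty.closure ⟨_, B, ⟨le_rfl, hBω⟩, rfl⟩)
  have hmem : ∀ β, B ≤ β → β < ω₁ → Fol x n (s β) → ∀ a, (play (s β) ∈ W a ↔ x ∈ W a) := by
    intro β h1 h2 h3
    exact hx _ (subset_closure ⟨β, ⟨h1, h2⟩, rfl⟩) ((fol_iff_play _ _ _).1 h3)
  have hunb : ∀ β < (ω₁ : Ordinal), ∃ γ, β ≤ γ ∧ γ < ω₁ ∧ Fol x n (s γ) := by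
    have h1 := hb (pre x n)
    simp only [pre_length, ← fol_iff_prefix] at h1
    apply h1
    obtain ⟨y, hy, β, ⟨hβ1, hβ2⟩, rfl⟩ := mem_closure_iff.1 hxP (PiNat.cylinder x n)
      (PiNat.isOpen_cylinder (fun _ : ℕ => M) x n) (PiNat.self_mem_cylinder x n)
    exact ⟨β, (hB _).trans hβ1, hβ2, (fol_iff_play _ _ _).2 hy⟩
  obtain ⟨γ, hBγ, hγω, hγ⟩ := hunb B hBω
  obtain ⟨a, hca, hla, hwa⟩ := hsucc γ ((hω1 γ hγω).trans_le hα)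
  have hγ1 : γ < γ + 1 := lt_add_one γ
  have hxa : x ∉ W a := fun h => hla ((hmem γ hBγ hγω hγ a).2 h)
  have hexit : ¬ Fol x n (s (γ + 1)) := fun h =>
    hxa ((hmem (γ + 1) (hBγ.trans hγ1.le) (hω1 γ hγω) h a).1 hwa)
  have hinv : ∀ β, γ + 1 ≤ β → β < ω₁ → Inv d a x n (s β) := by
    intro β
    induction β using WellFoundedLT.induction with
    | ind β ih =>
    intro h1 h2
    rcases h1.eq_or_lt with rfl | h1
    · exact exit_inv hca hγ hexit
    rcases Ordinal.zero_or_succ_or_isSuccLimit β with rfl | ⟨δ, rfl⟩ | hβ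
    · exact absurd h1 (by simp)
    · rw [Order.succ_eq_add_one] at h1 h2 ih ⊢
      have hδ : δ < δ + 1 := lt_add_one δ
      have hγδ : γ + 1 ≤ δ := Order.lt_add_one_iff.1 h1
      obtain ⟨c, hcc, -, hwc⟩ := hsucc δ (h2.trans_le hα)
      rcases step_inv hcc (ih δ hδ hγδ (hδ.trans h2)) with h | ⟨h, rfl⟩
      · exact h
      · exact absurd ((hmem (δ + 1) (hBγ.trans (hγ1.le.trans h1.le)) h2 h c).1 hwc) hxa
    · obtain ⟨δ, h3, h4, h5⟩ := hlim β (h2.trans_le hα) hβ (γ + 1) h1 _ (agree_nhds x n (s β))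
      obtain ⟨i, hin, hiw, hia, hir⟩ := ih δ h4 h3.le (h4.trans h2)
      refine ⟨i, hin, ?_, hia, fun j hj hjn => ?_⟩
      · rw [← h5 i hin]
        exact hiw
      · rw [← h5 j hjn]
        exact hir j hj hjn
  obtain ⟨δ, h1, h2, h3⟩ := hunb (γ + 1) (hω1 γ hγω)
  obtain ⟨i, hin, hiw, -⟩ := hinv δ h1 h2
  exact hiw (h3 i hin)

theorem extend {S : Type*} [TopologicalSpace S] (r : S → S → Prop) (α : Ordinal)
    (s : Ordinal → S) (hs : IsOrdSeq r α s) (x : S)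
    (h1 : ∀ β : Ordinal, β + 1 = α → r (s β) x)
    (h2 : Order.IsSuccLimit α → ∀ β' < α, ∀ U ∈ nhds x, ∃ γ : Ordinal, β' < γ ∧ γ < α ∧ s γ ∈ U) :
    IsOrdSeq r (α + 1) (fun β => if β = α then x else s β) := by
  constructor
  · intro β hβ
    have hβ' : β + 1 ≤ α := Order.lt_add_one_iff.1 hβ
    have hβα : β < α := (lt_add_one β).trans_le hβ'
    simp only [hβα.ne, if_false]
    split_ifs with h
    · exact h1 β h
    · exact hs.1 β (lt_of_le_of_ne hβ' h)
  · intro β hβ hl β' hβ' U hU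
    have hβα : β ≤ α := Order.lt_add_one_iff.1 hβ
    have aux : ∃ γ : Ordinal, β' < γ ∧ γ < β ∧ s γ ∈ U := by
      rcases hβα.eq_or_lt with rfl | h
      · exact h2 hl β' hβ' U (by simpa using hU)
      · exact hs.2 β h hl β' hβ' U (by simpa [h.ne] using hU)
    obtain ⟨γ, h3, h4, h5⟩ := aux
    refine ⟨γ, h3, h4, ?_⟩
    simpa [(h4.trans_le hβα).ne] using h5

theorem exists_cluster {S : Type*} [TopologicalSpace S] [CompactSpace S] (α : Ordinal)
    (s : Ordinal → S) (hα : Order.IsSuccLimit α) :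
    ∃ x : S, ∀ β' < α, ∀ U ∈ nhds x, ∃ γ : Ordinal, β' < γ ∧ γ < α ∧ s γ ∈ U := by
  have : Nonempty (Iio α) := ⟨⟨0, hα.bot_lt⟩⟩
  obtain ⟨x, -, hx⟩ := isCompact_univ.exists_mapClusterPt (f := (atTop : Filter (Iio α)))
    (u := fun β => s β.1) (by simp)
  refine ⟨x, fun β' hβ' U hU => ?_⟩
  have h1 := (mapClusterPt_iff_frequently.1 hx) U hU
  obtain ⟨γ, h2, h3⟩ := Filter.frequently_atTop.1 h1 ⟨β' + 1, hα.add_one_lt hβ'⟩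
  exact ⟨γ.1, (lt_add_one β').trans_le h2, γ.2, h3⟩

/-- Every improvement can be made lazy. -/
theorem lazy_of_conv {A M : Type*} (d : List M → A) (a : A) (t t' : List M → M)
    (h : Conv d a t t') : ∃ t'', LazyConv d a t t'' ∧ play t'' = play t' := by
  classical
  let u : List M → M := fun h => if OnPlay t' h then t' h else t h
  have hpre : ∀ n, OnPlay t' (playPrefix t' n) := by
    intro n
    unfold OnPlay
    rw [playPrefix_eq_pre t' n, pre_length, playPrefix_eq_pre]
  have hu : ∀ n, playPrefix u n = playPrefix t' n := by
    intro n
    induction n with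
    | zero => rfl
    | succ n ih => simp only [playPrefix, ih, u, hpre n, if_true]
  refine ⟨u, fun g hg => ?_, ?_⟩
  · by_cases hg' : OnPlay t' g
    · simp only [u, hg', if_true] at hg
      refine ⟨h g hg, ?_⟩
      unfold OnPlay
      rw [hu]
      exact hg'
    · simp [u, hg'] at hg
  · funext n
    simp only [play, hu, u, hpre n, if_true]

end LazyProof

open InfGame in
/-- In an infinite sequential game with finite branching (finitely many moves) and
finitely many players with win-lose `Δ⁰₂` objectives, every maximal ordinal-indexed
sequence of lazy improvement steps is countable and ends at a Nash equilibrium: its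
length is a successor `α = α' + 1` and its last element `s_{α'}` is a sink of the lazy
improvement relation and a Nash equilibrium of the game. -/
theorem lazy_ordSeq_of_deltaTwo_ends_at_nashEq {A M : Type*} [Finite A]
    [Finite M] [Nonempty M] [TopologicalSpace M] [DiscreteTopology M]
    (d : List M → A) (W : A → Set (ℕ → M))
    (hW : ∀ a : A, IsDeltaTwo (W a))
    (α : Ordinal) (s : Ordinal → (List M → M))
    (hs : IsOrdSeq (LazyWL d W) α s)
    (hmax : ¬ ∃ x : List M → M,
      IsOrdSeq (LazyWL d W) (α + 1) (fun β => if β = α then x else s β)) :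
    α.card ≤ Cardinal.aleph0 ∧
    ∃ α' : Ordinal, α = α' + 1 ∧
      (∀ t : List M → M, ¬ LazyWL d W (s α') t) ∧
      (∀ a : A, ∀ t : List M → M, ¬ (Conv d a (s α') t ∧
        play (s α') ∉ W a ∧ play t ∈ W a)) := by
  have hω := LazyProof.lt_omega_one d W hW α s hs
  refine ⟨?_, ?_⟩
  · rw [← Cardinal.ord_aleph, Cardinal.lt_ord] at hω
    rwa [← Order.lt_succ_iff, Cardinal.succ_aleph0]
  rcases Ordinal.zero_or_succ_or_isSuccLimit α with rfl | ⟨α', rfl⟩ | hl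
  · refine absurd ⟨fun _ => Classical.arbitrary M, LazyProof.extend _ _ s hs _ ?_ ?_⟩ hmax
    · intro β hβ
      exact absurd hβ (by simp)
    · intro h
      exact absurd h (by simp)
  · rw [Order.succ_eq_add_one] at hs hmax ⊢
    have hsink : ∀ t : List M → M, ¬ LazyWL d W (s α') t := by
      intro t ht
      refine hmax ⟨t, LazyProof.extend _ _ s hs _ ?_ ?_⟩
      · intro β hβ
        have h1 : β = α' := Order.succ_injective
          (by rwa [Order.succ_eq_add_one, Order.succ_eq_add_one])
        rwa [h1]
      · intro h
        exact absurd h (by simp)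
    refine ⟨α', rfl, hsink, ?_⟩
    rintro a t ⟨hc, hl, hw⟩
    obtain ⟨t', h1, h2⟩ := LazyProof.lazy_of_conv d a _ t hc
    exact hsink t' ⟨a, h1, hl, by rwa [h2]⟩
  · have : CompactSpace M := Finite.compactSpace
    obtain ⟨x, hx⟩ := LazyProof.exists_cluster α s hl
    refine absurd ⟨x, LazyProof.extend _ _ s hs x ?_ (fun _ => hx)⟩ hmax
    rintro β rfl
    exact absurd hl (by simp)
end
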